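/- Let Σ be a finite alphabet, L ⊆ Σ* a prefix-closed language, Σ_uc ⊆ Σ with Σ_c = Σ \ Σ_uc, and Σ_o ⊆ Σ with natural projection P. Assume every controllable event is observable, i.e., Σ_c ⊆ Σ_o. If K ⊆ L is controllable with respect to (L, Σ_uc) and observable with respect to (L, P, Σ_c), then K is normal with respect to (L, P). Consequently, under Σ_c ⊆ Σ_o, a sublanguage of L is controllable and observable if and only if it is controllable and normal. -/

import Mathlib

/-! Abstract supervisory control theory notions over a finite alphabet `E`.
Languages are sets of finite strings (lists) over `E`. -/

variable {E : Type*}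

/-- Prefix closure `pr(K)`: the set of all prefixes of strings of `K`. -/
def prefixClosure (K : Set (List E)) : Set (List E) := {s | ∃ t ∈ K, s <+: t}

/-- Controllability of `K` w.r.t. `(L, Euc)`. -/
def IsControllable (K L : Set (List E)) (Euc : Set E) : Prop :=
  ∀ s ∈ prefixClosure K, ∀ σ ∈ Euc, s ++ [σ] ∈ L → s ++ [σ] ∈ prefixClosure K

open Classical in
/-- Natural projection onto the observable events `Eo`: erases all events not in `Eo`. -/
noncomputable def natProj (Eo : Set E) (s : List E) : List E :=
  s.filter (fun a => decide (a ∈ Eo))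

/-- Observability of `K` w.r.t. `(L, P, Ec)`. -/
def IsObservable (K L : Set (List E)) (P : List E → List E) (Ec : Set E) : Prop :=
  ∀ s ∈ prefixClosure K, ∀ s' ∈ prefixClosure K, P s = P s' → ∀ σ ∈ Ec,
    s ++ [σ] ∈ prefixClosure K → s' ++ [σ] ∈ L → s' ++ [σ] ∈ prefixClosure K

/-- Normality of `K` w.r.t. `(L, P)`: `pr(K) = P⁻¹(P(pr(K))) ∩ L`. -/
def IsNormalLang (K L : Set (List E)) (P : List E → List E) : Prop :=
  prefixClosure K = {s | ∃ t ∈ prefixClosure K, P s = P t} ∩ L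

theorem mem_prefixClosure_of_prefix {K : Set (List E)} {s t : List E}
    (ht : t ∈ prefixClosure K) (hst : s <+: t) : s ∈ prefixClosure K := by
  obtain ⟨w, hw, htw⟩ := ht
  exact ⟨w, hw, hst.trans htw⟩

theorem prefixClosure_subset {K L : Set (List E)} (hLpc : prefixClosure L = L) (hKL : K ⊆ L) :
    prefixClosure K ⊆ L := by
  rintro s ⟨t, ht, hst⟩
  exact hLpc ▸ ⟨t, hKL ht, hst⟩

theorem natProj_append (Eo : Set E) (s t : List E) :
    natProj Eo (s ++ t) = natProj Eo s ++ natProj Eo t :=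
  List.filter_append ..

theorem natProj_singleton_of_mem {Eo : Set E} {σ : E} (h : σ ∈ Eo) : natProj Eo [σ] = [σ] := by
  simp [natProj, h]

theorem natProj_eq_append {Eo : Set E} {t x y : List E} (h : natProj Eo t = x ++ y) :
    ∃ t₁ t₂, t = t₁ ++ t₂ ∧ natProj Eo t₁ = x ∧ natProj Eo t₂ = y :=
  List.filter_eq_append_iff.1 h

theorem natProj_eq_append_singleton {Eo : Set E} {t x : List E} {σ : E}
    (h : natProj Eo t = x ++ [σ]) : ∃ t₁, t₁ ++ [σ] <+: t ∧ natProj Eo t₁ = x := by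
  obtain ⟨t₁, t₂, rfl, h₁, h₂⟩ := natProj_eq_append h
  obtain ⟨l₁, l₂, rfl, hl, -, -⟩ := List.filter_eq_cons_iff.1 h₂
  refine ⟨t₁ ++ l₁, ⟨l₂, by simp⟩, ?_⟩
  have hl' : natProj Eo l₁ = [] := List.filter_eq_nil_iff.2 hl
  rw [natProj_append, h₁, hl', List.append_nil]

/-- A controllable and observable sublanguage is normal when all controllable events are
observable. -/
theorem IsObservable.isNormalLang {K L : Set (List E)} {Euc Eo : Set E}
    (hLpc : prefixClosure L = L) (hco : Eucᶜ ⊆ Eo) (hKL : K ⊆ L)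
    (hO : IsObservable K L (natProj Eo) Eucᶜ) (hC : IsControllable K L Euc) :
    IsNormalLang K L (natProj Eo) := by
  refine Set.Subset.antisymm
    (fun s hs => ⟨⟨s, hs, rfl⟩, prefixClosure_subset hLpc hKL hs⟩) ?_
  rintro s ⟨⟨t, ht, hst⟩, hsL⟩
  induction s using List.reverseRecOn generalizing t with
  | nil => exact mem_prefixClosure_of_prefix ht List.nil_prefix
  | append_singleton u σ ih =>
    have huL : u ∈ L := by
      rw [← hLpc]
      exact ⟨_, hsL, List.prefix_append u [σ]⟩
    rw [natProj_append] at hst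
    by_cases hσ : σ ∈ Euc
    · obtain ⟨t₁, t₂, rfl, h₁, -⟩ := natProj_eq_append hst.symm
      have ht₁ := mem_prefixClosure_of_prefix ht (List.prefix_append t₁ t₂)
      exact hC u (ih huL t₁ ht₁ h₁.symm) σ hσ hsL
    · rw [natProj_singleton_of_mem (hco hσ)] at hst
      obtain ⟨t₁, hpre, h₁⟩ := natProj_eq_append_singleton hst.symm
      have htσ := mem_prefixClosure_of_prefix ht hpre
      have ht₁ := mem_prefixClosure_of_prefix htσ (List.prefix_append t₁ [σ])
      exact hO t₁ ht₁ u (ih huL t₁ ht₁ h₁.symm) h₁ σ hσ htσ hsL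

theorem IsNormalLang.isObservable {K L : Set (List E)} {Eo : Set E}
    (hN : IsNormalLang K L (natProj Eo)) (Ec : Set E) : IsObservable K L (natProj Eo) Ec := by
  intro s _ s' _ hss' σ _ hsσ hs'σ
  rw [hN]
  exact ⟨⟨s ++ [σ], hsσ, by rw [natProj_append, natProj_append, hss']⟩, hs'σ⟩

/-- assume every controllable event is observable, `Ec = Eᶜ \ Euc ⊆ Eo`.
If `K ⊆ L` is controllable w.r.t. `(L, Euc)` and observable w.r.t. `(L, P, Ec)`, then
`K` is normal w.r.t. `(L, P)`.  Consequently, under `Ec ⊆ Eo`, a sublanguage of `L` is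
controllable and observable iff it is controllable and normal. -/
theorem stmt2 [Fintype E] (L K : Set (List E)) (Euc Eo : Set E)
    (hLpc : prefixClosure L = L) (hco : Eucᶜ ⊆ Eo) (hKL : K ⊆ L)
    (hC : IsControllable K L Euc)
    (hO : IsObservable K L (natProj Eo) Eucᶜ) :
    IsNormalLang K L (natProj Eo) ∧
    ∀ K' ⊆ L, (IsControllable K' L Euc ∧ IsObservable K' L (natProj Eo) Eucᶜ ↔
               IsControllable K' L Euc ∧ IsNormalLang K' L (natProj Eo)) := by
  exact ⟨hO.isNormalLang hLpc hco hKL hC, fun K' hK' =>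
    ⟨fun h => ⟨h.1, h.2.isNormalLang hLpc hco hK' h.1⟩,
      fun h => ⟨h.1, h.2.isObservable Eucᶜ⟩⟩⟩
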